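/- Suppose $u_0 \in L^2_{uloc}(\mathbb{R}^3)$ and $u_0 \in L^3(B(x_0,3))$ for some $x_0$. Then $V = e^{t\Delta} u_0$ satisfies, for $0 < T \le 1$, $\|V\|_{L^8(0,T; L^4(B(x_0, 3/2)))} \le C\big(\|u_0\|_{L^3(B(x_0,3))} + T^{1/8}\|u_0\|_{L^2_{uloc}}\big)$ with $C$ an absolute constant. -/

import Mathlib

open MeasureTheory Metric Real ENNReal

noncomputable section

/-- The Gaussian heat kernel on `ℝ³`. -/
def heatKernel (t : ℝ) (x : EuclideanSpace ℝ (Fin 3)) : ℝ :=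
  (4 * π * t) ^ (-(3 : ℝ) / 2) * Real.exp (-‖x‖ ^ 2 / (4 * t))

/-- The heat kernel as an extended nonnegative function. -/
def heatKernelENN (t : ℝ) (x : EuclideanSpace ℝ (Fin 3)) : ℝ≥0∞ :=
  ENNReal.ofReal (heatKernel t x)

lemma ENNReal.add_pow_le_two_pow_mul (a b : ℝ≥0∞) (n : ℕ) :
    (a + b) ^ n ≤ 2 ^ n * (a ^ n + b ^ n) := by
  rcases le_total a b with h | h
  · calc (a + b) ^ n ≤ (2 * b) ^ n := by rw [two_mul]; gcongr
      _ = 2 ^ n * b ^ n := mul_pow _ _ _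
      _ ≤ _ := by gcongr; exact le_add_self
  · calc (a + b) ^ n ≤ (2 * a) ^ n := by rw [two_mul]; gcongr
      _ = 2 ^ n * a ^ n := mul_pow _ _ _
      _ ≤ _ := by gcongr; exact le_self_add

lemma lintegral_mul_sq_le_of_lintegral_le_one {α : Type*} [MeasurableSpace α] {μ : Measure α}
    {k h : α → ℝ≥0∞} (hk : Measurable k) (hh : Measurable h) (hk1 : ∫⁻ a, k a ∂μ ≤ 1) :
    (∫⁻ a, k a * h a ∂μ) ^ 2 ≤ ∫⁻ a, k a * h a ^ 2 ∂μ := by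
  have hpt : ∀ a, k a * h a = k a ^ (1 / 2 : ℝ) * (k a * h a ^ 2) ^ (1 / 2 : ℝ) := by
    intro a
    rw [ENNReal.mul_rpow_of_nonneg _ _ (by norm_num), ← mul_assoc,
      ← ENNReal.rpow_add_of_nonneg _ _ (by norm_num) (by norm_num), ← ENNReal.rpow_natCast,
      ← ENNReal.rpow_mul]
    norm_num
  calc (∫⁻ a, k a * h a ∂μ) ^ 2
      ≤ ((∫⁻ a, k a ∂μ) ^ (1 / 2 : ℝ) * (∫⁻ a, k a * h a ^ 2 ∂μ) ^ (1 / 2 : ℝ)) ^ 2 := by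
        gcongr
        rw [lintegral_congr hpt]
        exact ENNReal.lintegral_mul_norm_pow_le hk.aemeasurable
          (hk.mul (hh.pow_const 2)).aemeasurable (by norm_num) (by norm_num) (by norm_num)
    _ ≤ (1 * (∫⁻ a, k a * h a ^ 2 ∂μ) ^ (1 / 2 : ℝ)) ^ 2 := by
        gcongr
        exact ENNReal.rpow_le_one hk1 (by norm_num)
    _ = _ := by
        rw [one_mul, ← ENNReal.rpow_natCast, ← ENNReal.rpow_mul]
        norm_num

section Convolution

variable {k h : EuclideanSpace ℝ (Fin 3) → ℝ≥0∞}

lemma lintegral_lintegral_sub_mul_le (hk : Measurable k) (hh : Measurable h)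
    (hk1 : ∫⁻ x, k x ≤ 1) : ∫⁻ x, ∫⁻ y, k (x - y) * h y ≤ ∫⁻ y, h y := by
  rw [lintegral_lintegral_swap (by fun_prop)]
  refine lintegral_mono fun y => ?_
  rw [lintegral_mul_const _ (by fun_prop), lintegral_sub_right_eq_self]
  exact mul_le_of_le_one_left' hk1

lemma sq_lintegral_sub_mul_le (hk : Measurable k) (hh : Measurable h)
    (hk1 : ∫⁻ x, k x ≤ 1) (x : EuclideanSpace ℝ (Fin 3)) :
    (∫⁻ y, k (x - y) * h y) ^ 2 ≤ ∫⁻ y, k (x - y) * h y ^ 2 :=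
  lintegral_mul_sq_le_of_lintegral_le_one (by fun_prop) hh
    (by rwa [lintegral_sub_left_eq_self])

lemma lintegral_conv_pow_four_le (hk : Measurable k) (hh : Measurable h)
    (hk1 : ∫⁻ x, k x ≤ 1) :
    ∫⁻ x, (∫⁻ y, k (x - y) * h y) ^ 4 ≤ ∫⁻ y, h y ^ 4 := by
  calc ∫⁻ x, (∫⁻ y, k (x - y) * h y) ^ 4
      ≤ ∫⁻ x, ∫⁻ y, k (x - y) * h y ^ 4 := by
        refine lintegral_mono fun x => ?_
        calc (∫⁻ y, k (x - y) * h y) ^ 4 = ((∫⁻ y, k (x - y) * h y) ^ 2) ^ 2 := by ring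
          _ ≤ (∫⁻ y, k (x - y) * h y ^ 2) ^ 2 := by
            gcongr; exact sq_lintegral_sub_mul_le hk hh hk1 x
          _ ≤ ∫⁻ y, k (x - y) * (h y ^ 2) ^ 2 :=
            sq_lintegral_sub_mul_le hk (hh.pow_const 2) hk1 x
          _ = _ := by simp only [← pow_mul]
    _ ≤ _ := lintegral_lintegral_sub_mul_le hk (hh.pow_const 4) hk1

lemma lintegral_conv_pow_four_le_sq (hk : Measurable k) (hh : Measurable h)
    (hk1 : ∫⁻ x, k x ≤ 1) {s : ℝ≥0∞} (hs : ∀ x, k x ≤ s) :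
    ∫⁻ x, (∫⁻ y, k (x - y) * h y) ^ 4 ≤ s * (∫⁻ y, h y ^ 2) ^ 2 := by
  have hsup : ∀ x, ∫⁻ y, k (x - y) * h y ^ 2 ≤ s * ∫⁻ y, h y ^ 2 := fun x => by
    rw [← lintegral_const_mul _ (by fun_prop)]
    exact lintegral_mono fun y => by gcongr; exact hs _
  calc ∫⁻ x, (∫⁻ y, k (x - y) * h y) ^ 4
      ≤ ∫⁻ x, (s * ∫⁻ y, h y ^ 2) * ∫⁻ y, k (x - y) * h y ^ 2 := by
        refine lintegral_mono fun x => ?_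
        calc (∫⁻ y, k (x - y) * h y) ^ 4 = ((∫⁻ y, k (x - y) * h y) ^ 2) ^ 2 := by ring
          _ ≤ (∫⁻ y, k (x - y) * h y ^ 2) ^ 2 := by
            gcongr; exact sq_lintegral_sub_mul_le hk hh hk1 x
          _ ≤ _ := by rw [sq]; gcongr; exact hsup x
    _ = (s * ∫⁻ y, h y ^ 2) * ∫⁻ x, ∫⁻ y, k (x - y) * h y ^ 2 :=
        lintegral_const_mul _ (Measurable.lintegral_prod_right (by fun_prop))
    _ ≤ (s * ∫⁻ y, h y ^ 2) * ∫⁻ y, h y ^ 2 := by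
        exact mul_le_mul' le_rfl (lintegral_lintegral_sub_mul_le hk (hh.pow_const 2) hk1)
    _ = _ := by ring

end Convolution

lemma lintegral_exp_neg_mul_sq_norm {b : ℝ} (hb : 0 < b) :
    ∫⁻ x : EuclideanSpace ℝ (Fin 3), ENNReal.ofReal (Real.exp (-b * ‖x‖ ^ 2)) =
      ENNReal.ofReal ((π / b) ^ (3 / 2 : ℝ)) := by
  have h := GaussianFourier.integral_rexp_neg_mul_sq_norm (V := EuclideanSpace ℝ (Fin 3)) hb
  have hpos : (0 : ℝ) < (π / b) ^ (3 / 2 : ℝ) := by positivity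
  simp only [finrank_euclideanSpace, Fintype.card_fin, Nat.cast_ofNat] at h
  rw [← h, ofReal_integral_eq_lintegral_ofReal _ (ae_of_all _ fun x => (Real.exp_pos _).le)]
  by_contra hint
  rw [integral_undef hint] at h
  exact hpos.ne h

lemma measurable_heatKernelENN :
    Measurable fun p : ℝ × EuclideanSpace ℝ (Fin 3) => heatKernelENN p.1 p.2 := by
  unfold heatKernelENN heatKernel
  fun_prop

lemma measurable_heatKernelENN_right (t : ℝ) : Measurable (heatKernelENN t) :=
  measurable_heatKernelENN.comp measurable_prodMk_left

lemma heatKernel_nonneg {t : ℝ} (ht : 0 ≤ t) (x : EuclideanSpace ℝ (Fin 3)) :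
    0 ≤ heatKernel t x := by
  unfold heatKernel; positivity

lemma lintegral_heatKernelENN_le {t : ℝ} (ht : 0 < t) : ∫⁻ x, heatKernelENN t x ≤ 1 := by
  have hb : 0 < 1 / (4 * t) := by positivity
  have hexp : ∀ x : EuclideanSpace ℝ (Fin 3), heatKernelENN t x =
      ENNReal.ofReal ((4 * π * t) ^ (-(3 : ℝ) / 2)) *
        ENNReal.ofReal (Real.exp (-(1 / (4 * t)) * ‖x‖ ^ 2)) := fun x => by
    rw [heatKernelENN, heatKernel, ENNReal.ofReal_mul (by positivity)]
    congr 3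
    ring
  simp only [hexp]
  rw [lintegral_const_mul _ (by fun_prop), lintegral_exp_neg_mul_sq_norm hb,
    ← ENNReal.ofReal_mul (by positivity),
    show π / (1 / (4 * t)) = 4 * π * t by field_simp, ← Real.rpow_add (by positivity)]
  norm_num

lemma heatKernel_prefactor_le {t : ℝ} (ht : 0 < t) :
    (4 * π * t) ^ (-(3 : ℝ) / 2) ≤ t ^ (-(3 : ℝ) / 2) :=
  Real.rpow_le_rpow_of_nonpos ht (by nlinarith [Real.pi_gt_three]) (by norm_num)

lemma heatKernelENN_le {t : ℝ} (ht : 0 < t) (x : EuclideanSpace ℝ (Fin 3)) :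
    heatKernelENN t x ≤ ENNReal.ofReal (t ^ (-(1 / 2) : ℝ)) ^ 3 := by
  rw [← ENNReal.ofReal_pow (by positivity), ← Real.rpow_natCast, ← Real.rpow_mul ht.le]
  refine ENNReal.ofReal_le_ofReal ?_
  have h1 : Real.exp (-‖x‖ ^ 2 / (4 * t)) ≤ 1 :=
    Real.exp_le_one_iff.2 (div_nonpos_of_nonpos_of_nonneg (by simp) (by positivity))
  calc heatKernel t x ≤ (4 * π * t) ^ (-(3 : ℝ) / 2) :=
        mul_le_of_le_one_right (by positivity) h1
    _ ≤ t ^ (-(3 : ℝ) / 2) := heatKernel_prefactor_le ht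
    _ = _ := by norm_num

lemma heatKernel_le_of_one_le_norm {t : ℝ} (ht : 0 < t) (ht1 : t ≤ 1)
    {x : EuclideanSpace ℝ (Fin 3)} (hx : 1 ≤ ‖x‖) :
    heatKernel t x ≤ 128 * Real.exp (-‖x‖ ^ 2 / 8) := by
  have hx2 : 1 ≤ ‖x‖ ^ 2 := one_le_pow₀ hx
  have hinv : 1 ≤ t⁻¹ := (one_le_inv₀ ht).2 ht1
  have hpre : t ^ (-(3 : ℝ) / 2) ≤ t⁻¹ ^ 2 := by
    rw [neg_div, Real.rpow_neg ht.le, ← Real.inv_rpow ht.le, ← Real.rpow_natCast]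
    exact Real.rpow_le_rpow_of_exponent_le hinv (by norm_num)
  have hexp : Real.exp (-‖x‖ ^ 2 / (4 * t)) ≤
      Real.exp (-(t⁻¹ / 8)) * Real.exp (-‖x‖ ^ 2 / 8) := by
    rw [← Real.exp_add, Real.exp_le_exp,
      show -‖x‖ ^ 2 / (4 * t) = -(‖x‖ ^ 2 * t⁻¹ / 4) by field_simp]
    nlinarith [mul_le_mul_of_nonneg_right hx2 (zero_le_one.trans hinv),
      mul_le_mul_of_nonneg_left hinv (zero_le_one.trans hx2)]
  have hquad : t⁻¹ ^ 2 * Real.exp (-(t⁻¹ / 8)) ≤ 128 := by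
    rw [Real.exp_neg, ← div_eq_mul_inv, div_le_iff₀ (Real.exp_pos _)]
    have := Real.pow_div_factorial_le_exp (t⁻¹ / 8) (by positivity) 2
    norm_num only [Nat.factorial] at this
    linarith
  calc heatKernel t x
      ≤ t⁻¹ ^ 2 * (Real.exp (-(t⁻¹ / 8)) * Real.exp (-‖x‖ ^ 2 / 8)) :=
        mul_le_mul ((heatKernel_prefactor_le ht).trans hpre) hexp (Real.exp_pos _).le
          (by positivity)
    _ = t⁻¹ ^ 2 * Real.exp (-(t⁻¹ / 8)) * Real.exp (-‖x‖ ^ 2 / 8) := by ring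
    _ ≤ _ := by gcongr

lemma exists_lintegral_gaussian_mul_le :
    ∃ A : ℝ≥0∞, A ≠ ⊤ ∧ ∀ (w : EuclideanSpace ℝ (Fin 3) → ℝ≥0∞), Measurable w →
      ∀ m : ℝ≥0∞, (∀ z, ∫⁻ y in ball z 1, w y ≤ m) → ∀ x,
        ∫⁻ y, ENNReal.ofReal (Real.exp (-‖x - y‖ ^ 2 / 8)) * w y ≤ A * m := by
  set E := EuclideanSpace ℝ (Fin 3)
  set β : ℝ≥0∞ := volume (ball (0 : E) 1) with hβ
  have hβ0 : β ≠ 0 := (measure_ball_pos volume _ one_pos).ne'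
  have hβt : β ≠ ⊤ := measure_ball_lt_top.ne
  set I : ℝ≥0∞ := ∫⁻ z : E, ENNReal.ofReal (Real.exp (-(1 / 16) * ‖z‖ ^ 2)) with hI
  have hIt : I ≠ ⊤ := by
    rw [hI, lintegral_exp_neg_mul_sq_norm (by norm_num)]
    exact ENNReal.ofReal_ne_top
  refine ⟨β⁻¹ * (2 * I), by finiteness, fun w hw m hm x => ?_⟩
  set G : E → ℝ≥0∞ := fun y => ENNReal.ofReal (Real.exp (-‖x - y‖ ^ 2 / 8)) with hG
  have hGm : Measurable G := by fun_prop
  have hset : MeasurableSet {p : E × E | dist p.1 p.2 < 1} :=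
    measurableSet_lt (by fun_prop) (by fun_prop)
  have hcomp : ∀ y z : E, dist y z < 1 →
      G y ≤ 2 * ENNReal.ofReal (Real.exp (-(1 / 16) * ‖x - z‖ ^ 2)) := by
    intro y z hyz
    refine le_trans (ENNReal.ofReal_le_ofReal
      (q := 2 * Real.exp (-(1 / 16) * ‖x - z‖ ^ 2)) ?_)
      (by rw [ENNReal.ofReal_mul zero_le_two, ENNReal.ofReal_ofNat])
    have h1 : ‖x - z‖ ≤ ‖x - y‖ + 1 := by
      have := norm_add_le (x - y) (y - z)
      rw [sub_add_sub_cancel] at this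
      rw [dist_eq_norm] at hyz
      linarith
    have h2 : Real.exp (1 / 8) ≤ 2 := by
      have := Real.exp_bound_div_one_sub_of_interval (x := 1 / 8) (by norm_num) (by norm_num)
      norm_num at this ⊢
      linarith
    calc Real.exp (-‖x - y‖ ^ 2 / 8)
        ≤ Real.exp (1 / 8 + -(1 / 16) * ‖x - z‖ ^ 2) := by
          rw [Real.exp_le_exp]
          nlinarith [norm_nonneg (x - y), norm_nonneg (x - z), sq_nonneg (‖x - y‖ - 1),
            pow_le_pow_left₀ (norm_nonneg (x - z)) h1 2]
      _ ≤ _ := by rw [Real.exp_add]; gcongr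
  have key : β * ∫⁻ y, G y * w y ≤ 2 * I * m := by
    calc β * ∫⁻ y, G y * w y
        = ∫⁻ y, ∫⁻ z, {p : E × E | dist p.1 p.2 < 1}.indicator (fun p => G p.1 * w p.1) (y, z) := by
          rw [← lintegral_const_mul _ (by fun_prop)]
          refine lintegral_congr fun y => ?_
          have : ∀ z, {p : E × E | dist p.1 p.2 < 1}.indicator (fun p => G p.1 * w p.1) (y, z) =
              (ball y 1).indicator (fun _ => G y * w y) z := fun z => by
            by_cases hyz : dist y z < 1
            · rw [Set.indicator_of_mem (mem_ball'.2 hyz), Set.indicator_of_mem]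
              exact hyz
            · rw [Set.indicator_of_notMem (mt mem_ball'.1 hyz), Set.indicator_of_notMem]
              exact hyz
          simp only [this]
          rw [lintegral_indicator measurableSet_ball, setLIntegral_const,
            Measure.addHaar_ball_center, mul_comm]
      _ = ∫⁻ z, ∫⁻ y, {p : E × E | dist p.1 p.2 < 1}.indicator (fun p => G p.1 * w p.1) (y, z) := by
          refine lintegral_lintegral_swap (Measurable.aemeasurable ?_)
          exact Measurable.indicator (by fun_prop) hset
      _ ≤ ∫⁻ z, 2 * ENNReal.ofReal (Real.exp (-(1 / 16) * ‖x - z‖ ^ 2)) * m := by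
          refine lintegral_mono fun z => ?_
          calc ∫⁻ y, {p : E × E | dist p.1 p.2 < 1}.indicator (fun p => G p.1 * w p.1) (y, z)
              ≤ ∫⁻ y, 2 * ENNReal.ofReal (Real.exp (-(1 / 16) * ‖x - z‖ ^ 2)) *
                  (ball z 1).indicator w y := by
                refine lintegral_mono fun y => ?_
                by_cases hyz : dist y z < 1
                · simpa [hyz] using
                    mul_le_mul_left (hcomp y z hyz) (w y)
                · simp [hyz]
            _ ≤ _ := by
                rw [lintegral_const_mul _ (hw.indicator measurableSet_ball),
                  lintegral_indicator measurableSet_ball]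
                gcongr
                exact hm z
      _ = _ := by
          rw [lintegral_mul_const _ (by fun_prop), lintegral_const_mul _ (by fun_prop),
            lintegral_sub_left_eq_self
              (fun z : E => ENNReal.ofReal (Real.exp (-(1 / 16) * ‖z‖ ^ 2)))]
  calc ∫⁻ y, G y * w y = β⁻¹ * (β * ∫⁻ y, G y * w y) := by
        rw [← mul_assoc, ENNReal.inv_mul_cancel hβ0 hβt, one_mul]
    _ ≤ β⁻¹ * (2 * I * m) := by gcongr
    _ = _ := by ring

lemma lintegral_Ioc_rpow_neg_half {c : ℝ} (hc : 0 < c) :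
    ∫⁻ t in Set.Ioc 0 (c ^ 2), ENNReal.ofReal (t ^ (-(1 / 2) : ℝ)) = ENNReal.ofReal (2 * c) := by
  have hint : IntervalIntegrable (fun t : ℝ => t ^ (-(1 / 2) : ℝ)) volume 0 (c ^ 2) :=
    intervalIntegral.intervalIntegrable_rpow' (by norm_num)
  rw [← ofReal_integral_eq_lintegral_ofReal
      ((intervalIntegrable_iff_integrableOn_Ioc_of_le (sq_nonneg c)).1 hint)
      ((ae_restrict_iff' measurableSet_Ioc).2 (ae_of_all _ fun t ht => Real.rpow_nonneg ht.1.le _)),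
    ← intervalIntegral.integral_of_le (sq_nonneg c), integral_rpow (Or.inl (by norm_num)),
    ← Real.rpow_natCast, ← Real.rpow_mul hc.le]
  norm_num
  ring_nf
  rw [ENNReal.ofReal_mul hc.le, ENNReal.ofReal_ofNat]

lemma lintegral_Ioi_rpow_neg_three_half {c : ℝ} (hc : 0 < c) :
    ∫⁻ t in Set.Ioi (c ^ 2), ENNReal.ofReal (t ^ (-(3 / 2) : ℝ)) = ENNReal.ofReal (2 / c) := by
  have hc2 : 0 < c ^ 2 := by positivity
  rw [← ofReal_integral_eq_lintegral_ofReal (integrableOn_Ioi_rpow_of_lt (by norm_num) hc2)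
      ((ae_restrict_iff' measurableSet_Ioi).2
        (ae_of_all _ fun t ht => Real.rpow_nonneg (hc2.trans ht).le _)),
    integral_Ioi_rpow_of_lt (by norm_num) hc2, ← Real.rpow_natCast, ← Real.rpow_mul hc.le]
  norm_num [Real.rpow_neg_one]
  ring_nf

/-- The function `t ↦ t ^ (-1/2)` with values in the extended nonnegative reals. -/
def invSqrtENN (t : ℝ) : ℝ≥0∞ := ENNReal.ofReal (t ^ (-(1 / 2) : ℝ))

lemma measurable_invSqrtENN : Measurable invSqrtENN := by
  unfold invSqrtENN
  fun_prop

lemma invSqrtENN_pow_three {t : ℝ} (ht : 0 < t) :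
    invSqrtENN t ^ 3 = ENNReal.ofReal (t ^ (-(3 / 2) : ℝ)) := by
  rw [invSqrtENN, ← ENNReal.ofReal_pow (by positivity), ← Real.rpow_natCast, ← Real.rpow_mul ht.le]
  norm_num

lemma ofReal_mul_invSqrtENN {a t : ℝ} (ha : 0 < a) (ht : 0 < t) :
    ENNReal.ofReal a * invSqrtENN t = ENNReal.ofReal (a / √t) := by
  rw [invSqrtENN, ← ENNReal.ofReal_mul ha.le, Real.rpow_neg ht.le, ← Real.sqrt_eq_rpow,
    div_eq_mul_inv]

lemma ofReal_le_ofReal_mul_invSqrtENN_iff {a r t : ℝ} (ha : 0 < a) (hr : 0 < r) (ht : 0 < t) :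
    ENNReal.ofReal r ≤ ENNReal.ofReal a * invSqrtENN t ↔ t ≤ (a / r) ^ 2 := by
  rw [ofReal_mul_invSqrtENN ha ht, ENNReal.ofReal_le_ofReal_iff (by positivity),
    le_div_iff₀ (Real.sqrt_pos.2 ht), ← Real.sqrt_le_left (by positivity), le_div_iff₀ hr, mul_comm]

lemma lintegral_low_level_le {a : ℝ} (ha : 0 < a) {f : ℝ≥0∞} (hf : f ≠ ⊤) :
    ∫⁻ t in Set.Ioi (0 : ℝ), (if f ≤ ENNReal.ofReal a * invSqrtENN t then
      ENNReal.ofReal a * invSqrtENN t * f ^ 4 else 0) ≤ 2 * ENNReal.ofReal a ^ 2 * f ^ 3 := by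
  rcases eq_or_ne f 0 with rfl | hf0
  · simp
  obtain ⟨r, hr, rfl⟩ : ∃ r : ℝ, 0 < r ∧ ENNReal.ofReal r = f :=
    ⟨f.toReal, ENNReal.toReal_pos hf0 hf, ENNReal.ofReal_toReal hf⟩
  have hc : 0 < a / r := by positivity
  calc _ ≤ ∫⁻ t in Set.Ioi (0 : ℝ), (Set.Ioc 0 ((a / r) ^ 2)).indicator
          (fun t => ENNReal.ofReal a * ENNReal.ofReal r ^ 4 * invSqrtENN t) t := by
        refine setLIntegral_mono' measurableSet_Ioi fun t ht => ?_
        split_ifs with h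
        · rw [Set.indicator_of_mem (Set.mem_Ioc.2
            ⟨ht, (ofReal_le_ofReal_mul_invSqrtENN_iff ha hr ht).1 h⟩)]
          exact le_of_eq (by ring)
        · exact zero_le
    _ ≤ ∫⁻ t, (Set.Ioc 0 ((a / r) ^ 2)).indicator
          (fun t => ENNReal.ofReal a * ENNReal.ofReal r ^ 4 * invSqrtENN t) t :=
        setLIntegral_le_lintegral _ _
    _ = ENNReal.ofReal a * ENNReal.ofReal r ^ 4 * ENNReal.ofReal (2 * (a / r)) := by
        rw [lintegral_indicator measurableSet_Ioc, lintegral_const_mul _ measurable_invSqrtENN]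
        congr 1
        exact lintegral_Ioc_rpow_neg_half hc
    _ = _ := by
        rw [← ENNReal.ofReal_ofNat 2]
        simp only [← ENNReal.ofReal_pow ha.le, ← ENNReal.ofReal_pow hr.le]
        rw [← ENNReal.ofReal_mul (by positivity), ← ENNReal.ofReal_mul (by positivity),
          ← ENNReal.ofReal_mul (by positivity), ← ENNReal.ofReal_mul (by positivity)]
        congr 1
        field_simp

lemma lintegral_high_level_le {a : ℝ} (ha : 0 < a) {f : ℝ≥0∞} (hf : f ≠ ⊤) :
    ∫⁻ t in Set.Ioi (0 : ℝ), (if ENNReal.ofReal a * invSqrtENN t < f then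
      invSqrtENN t ^ 3 * f ^ 2 else 0) ≤ 2 * (ENNReal.ofReal a)⁻¹ * f ^ 3 := by
  rcases eq_or_ne f 0 with rfl | hf0
  · simp
  obtain ⟨r, hr, rfl⟩ : ∃ r : ℝ, 0 < r ∧ ENNReal.ofReal r = f :=
    ⟨f.toReal, ENNReal.toReal_pos hf0 hf, ENNReal.ofReal_toReal hf⟩
  have hc : 0 < a / r := by positivity
  calc _ ≤ ∫⁻ t in Set.Ioi (0 : ℝ), (Set.Ioi ((a / r) ^ 2)).indicator
          (fun t => ENNReal.ofReal r ^ 2 * ENNReal.ofReal (t ^ (-(3 / 2) : ℝ))) t := by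
        refine setLIntegral_mono' measurableSet_Ioi fun t ht => ?_
        split_ifs with h
        · rw [Set.indicator_of_mem (Set.mem_Ioi.2 (not_le.1 (mt
            (ofReal_le_ofReal_mul_invSqrtENN_iff ha hr ht).2 h.not_ge))), invSqrtENN_pow_three ht]
          exact le_of_eq (by ring)
        · exact zero_le
    _ ≤ ∫⁻ t, (Set.Ioi ((a / r) ^ 2)).indicator
          (fun t => ENNReal.ofReal r ^ 2 * ENNReal.ofReal (t ^ (-(3 / 2) : ℝ))) t :=
        setLIntegral_le_lintegral _ _
    _ = ENNReal.ofReal r ^ 2 * ENNReal.ofReal (2 / (a / r)) := by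
        rw [lintegral_indicator measurableSet_Ioi, lintegral_const_mul _ (by fun_prop),
          lintegral_Ioi_rpow_neg_three_half hc]
    _ = _ := by
        rw [← ENNReal.ofReal_ofNat 2, ← ENNReal.ofReal_inv_of_pos ha]
        simp only [← ENNReal.ofReal_pow hr.le]
        rw [← ENNReal.ofReal_mul (by positivity), ← ENNReal.ofReal_mul (by positivity),
          ← ENNReal.ofReal_mul (by positivity)]
        congr 1
        field_simp

lemma sq_lintegral_heat_pow_four_le {h : EuclideanSpace ℝ (Fin 3) → ℝ≥0∞} (hh : Measurable h)
    {A : ℝ≥0∞} (hA0 : A ≠ 0) (hAt : A ≠ ⊤) {t : ℝ} (ht : 0 < t) :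
    (∫⁻ x, (∫⁻ y, heatKernelENN t (x - y) * h y) ^ 4) ^ 2 ≤
      1024 * ((∫⁻ x, h x ^ 3) *
          (∫⁻ x, if h x ≤ A * invSqrtENN t then A * invSqrtENN t * h x ^ 4 else 0) +
        A⁻¹ ^ 3 * (∫⁻ x, h x ^ 3) ^ 3 *
          ∫⁻ x, if A * invSqrtENN t < h x then invSqrtENN t ^ 3 * h x ^ 2 else 0) := by
  set N := ∫⁻ x, h x ^ 3
  set τ := invSqrtENN t
  set l := A * τ with hl
  have hs1 : MeasurableSet {x | h x ≤ l} := measurableSet_le hh measurable_const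
  have hs2 : MeasurableSet {x | l < h x} := measurableSet_lt measurable_const hh
  set h₁ := {x | h x ≤ l}.indicator h with hh₁
  set h₂ := {x | l < h x}.indicator h with hh₂
  have hm1 : Measurable h₁ := hh.indicator hs1
  have hm2 : Measurable h₂ := hh.indicator hs2
  have hk := measurable_heatKernelENN_right t
  have hk1 := lintegral_heatKernelENN_le ht
  have hadd : ∀ y, h y = h₁ y + h₂ y := fun y => by
    by_cases hy : h y ≤ l
    · simp [hh₁, hh₂, hy, not_lt.2 hy]
    · simp [hh₁, hh₂, hy, not_le.1 hy]
  have hconv : ∀ x, ∫⁻ y, heatKernelENN t (x - y) * h y =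
      (∫⁻ y, heatKernelENN t (x - y) * h₁ y) + ∫⁻ y, heatKernelENN t (x - y) * h₂ y := fun x => by
    rw [← lintegral_add_left (by fun_prop)]
    exact lintegral_congr fun y => by rw [hadd y, mul_add]
  set S₁ := ∫⁻ y, h₁ y ^ 4 with hS₁
  set S₂ := ∫⁻ y, h₂ y ^ 2 with hS₂
  have hfour : ∫⁻ x, (∫⁻ y, heatKernelENN t (x - y) * h y) ^ 4 ≤
      2 ^ 4 * (S₁ + τ ^ 3 * S₂ ^ 2) := by
    calc ∫⁻ x, (∫⁻ y, heatKernelENN t (x - y) * h y) ^ 4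
        ≤ ∫⁻ x, 2 ^ 4 * ((∫⁻ y, heatKernelENN t (x - y) * h₁ y) ^ 4 +
            (∫⁻ y, heatKernelENN t (x - y) * h₂ y) ^ 4) :=
          lintegral_mono fun x => by
            rw [hconv x]; exact ENNReal.add_pow_le_two_pow_mul _ _ _
      _ = 2 ^ 4 * ((∫⁻ x, (∫⁻ y, heatKernelENN t (x - y) * h₁ y) ^ 4) +
            ∫⁻ x, (∫⁻ y, heatKernelENN t (x - y) * h₂ y) ^ 4) := by
          have hc1 : Measurable fun x => (∫⁻ y, heatKernelENN t (x - y) * h₁ y) ^ 4 :=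
            (Measurable.lintegral_prod_right (by fun_prop)).pow_const 4
          rw [lintegral_const_mul' _ _ (by finiteness), lintegral_add_left hc1]
      _ ≤ _ := by
          gcongr
          · exact lintegral_conv_pow_four_le hk hm1 hk1
          · exact lintegral_conv_pow_four_le_sq hk hm2 hk1 (heatKernelENN_le ht)
  have hS₁N : S₁ ≤ l * N := by
    rw [← lintegral_const_mul _ (by fun_prop)]
    refine lintegral_mono fun x => ?_
    by_cases hx : h x ≤ l
    · simp only [hh₁, Set.indicator_of_mem (s := {x | h x ≤ l}) hx]
      rw [pow_succ']
      gcongr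
    · simp [hh₁, hx]
  have hS₂N : l * S₂ ≤ N := by
    rw [← lintegral_const_mul _ (by fun_prop)]
    refine lintegral_mono fun x => ?_
    by_cases hx : l < h x
    · simp only [hh₂, Set.indicator_of_mem (s := {x | l < h x}) hx]
      rw [pow_succ' _ 2]
      gcongr
    · simp [hh₂, hx]
  have hlow : (∫⁻ x, if h x ≤ l then l * h x ^ 4 else 0) = l * S₁ := by
    rw [← lintegral_const_mul _ (by fun_prop)]
    refine lintegral_congr fun x => ?_
    by_cases hx : h x ≤ l <;> simp [hh₁, hx]
  have hhigh : (∫⁻ x, if l < h x then τ ^ 3 * h x ^ 2 else 0) = τ ^ 3 * S₂ := by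
    rw [← lintegral_const_mul _ (by fun_prop)]
    refine lintegral_congr fun x => ?_
    by_cases hx : l < h x <;> simp [hh₂, hx]
  rw [hlow, hhigh]
  calc _ ≤ (2 ^ 4 * (S₁ + τ ^ 3 * S₂ ^ 2)) ^ 2 := by gcongr
    _ = 2 ^ 8 * (S₁ + τ ^ 3 * S₂ ^ 2) ^ 2 := by ring
    _ ≤ 2 ^ 8 * (2 ^ 2 * (S₁ ^ 2 + (τ ^ 3 * S₂ ^ 2) ^ 2)) := by
        gcongr; exact ENNReal.add_pow_le_two_pow_mul _ _ _
    _ = 1024 * (S₁ * S₁ + (A⁻¹ * A) ^ 3 * (τ ^ 3 * S₂ ^ 2) ^ 2) := by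
        rw [ENNReal.inv_mul_cancel hA0 hAt]; ring
    _ = 1024 * (S₁ * S₁ + A⁻¹ ^ 3 * (l * S₂) ^ 3 * (τ ^ 3 * S₂)) := by rw [hl]; ring
    _ ≤ 1024 * ((l * N) * S₁ + A⁻¹ ^ 3 * N ^ 3 * (τ ^ 3 * S₂)) := by gcongr
    _ = _ := by ring

/-- Giga's space-time estimate `‖e^{tΔ} h‖_{L⁸(0,∞;L⁴)} ≲ ‖h‖_{L³}` for nonnegative data. -/
lemma lintegral_sq_lintegral_heat_pow_four_le {h : EuclideanSpace ℝ (Fin 3) → ℝ≥0∞}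
    (hh : Measurable h) {X : ℝ≥0∞} (hX : ∫⁻ x, h x ^ 3 = X ^ 3) (hXt : X ≠ ⊤) :
    ∫⁻ t in Set.Ioi (0 : ℝ), (∫⁻ x, (∫⁻ y, heatKernelENN t (x - y) * h y) ^ 4) ^ 2 ≤
      4096 * X ^ 8 := by
  have htop : ∀ᵐ x, h x ≠ ⊤ := by
    have := ae_lt_top (hh.pow_const 3) (by rw [hX]; finiteness)
    filter_upwards [this] with x hx hx'
    simp [hx'] at hx
  have hbound : ∀ a : ℝ, 0 < a →
      ∫⁻ t in Set.Ioi (0 : ℝ), (∫⁻ x, (∫⁻ y, heatKernelENN t (x - y) * h y) ^ 4) ^ 2 ≤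
        2048 * (ENNReal.ofReal a ^ 2 * X ^ 6 + (ENNReal.ofReal a)⁻¹ ^ 4 * X ^ 12) := by
    intro a ha
    set A := ENNReal.ofReal a with hA
    have hA0 : A ≠ 0 := by simpa [hA] using ha
    have hAt : A ≠ ⊤ := ENNReal.ofReal_ne_top
    have hτ := measurable_invSqrtENN
    have hlow : Measurable fun p : ℝ × EuclideanSpace ℝ (Fin 3) =>
        if h p.2 ≤ A * invSqrtENN p.1 then A * invSqrtENN p.1 * h p.2 ^ 4 else 0 :=
      Measurable.ite (measurableSet_le (by fun_prop) (by fun_prop)) (by fun_prop) measurable_const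
    have hhigh : Measurable fun p : ℝ × EuclideanSpace ℝ (Fin 3) =>
        if A * invSqrtENN p.1 < h p.2 then invSqrtENN p.1 ^ 3 * h p.2 ^ 2 else 0 :=
      Measurable.ite (measurableSet_lt (by fun_prop) (by fun_prop)) (by fun_prop) measurable_const
    calc _ ≤ ∫⁻ t in Set.Ioi (0 : ℝ), 1024 * (X ^ 3 *
              (∫⁻ x, if h x ≤ A * invSqrtENN t then A * invSqrtENN t * h x ^ 4 else 0) +
            A⁻¹ ^ 3 * (X ^ 3) ^ 3 *
              ∫⁻ x, if A * invSqrtENN t < h x then invSqrtENN t ^ 3 * h x ^ 2 else 0) := by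
          refine setLIntegral_mono' measurableSet_Ioi fun t ht => ?_
          rw [← hX]
          exact sq_lintegral_heat_pow_four_le hh hA0 hAt ht
      _ = 1024 * (X ^ 3 * (∫⁻ x, ∫⁻ t in Set.Ioi (0 : ℝ),
              if h x ≤ A * invSqrtENN t then A * invSqrtENN t * h x ^ 4 else 0) +
            A⁻¹ ^ 3 * (X ^ 3) ^ 3 * ∫⁻ x, ∫⁻ t in Set.Ioi (0 : ℝ),
              if A * invSqrtENN t < h x then invSqrtENN t ^ 3 * h x ^ 2 else 0) := by
          rw [lintegral_const_mul' _ _ (by finiteness),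
            lintegral_add_left ((Measurable.lintegral_prod_right hlow).const_mul _),
            lintegral_const_mul' _ _ (by finiteness), lintegral_const_mul' _ _ (by finiteness),
            lintegral_lintegral_swap (f := fun t x =>
              if h x ≤ A * invSqrtENN t then A * invSqrtENN t * h x ^ 4 else 0)
              hlow.aemeasurable,
            lintegral_lintegral_swap (f := fun t x =>
              if A * invSqrtENN t < h x then invSqrtENN t ^ 3 * h x ^ 2 else 0)
              hhigh.aemeasurable]
      _ ≤ 1024 * (X ^ 3 * (∫⁻ x, 2 * A ^ 2 * h x ^ 3) +
            A⁻¹ ^ 3 * (X ^ 3) ^ 3 * ∫⁻ x, 2 * A⁻¹ * h x ^ 3) := by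
          gcongr 1024 * (X ^ 3 * ?_ + A⁻¹ ^ 3 * (X ^ 3) ^ 3 * ?_)
          · refine lintegral_mono_ae ?_
            filter_upwards [htop] with x hx using lintegral_low_level_le ha hx
          · refine lintegral_mono_ae ?_
            filter_upwards [htop] with x hx using lintegral_high_level_le ha hx
      _ = _ := by
          rw [lintegral_const_mul _ (by fun_prop), lintegral_const_mul _ (by fun_prop), hX]
          ring
  rcases eq_or_ne X 0 with rfl | hX0
  · simpa using hbound 1 one_pos
  · refine (hbound X.toReal (ENNReal.toReal_pos hX0 hXt)).trans (le_of_eq ?_)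
    rw [ENNReal.ofReal_toReal hXt,
      show X⁻¹ ^ 4 * X ^ 12 = (X⁻¹ * X) ^ 4 * X ^ 8 by ring, ENNReal.inv_mul_cancel hX0 hXt]
    ring

lemma exists_far_heat_le :
    ∃ A : ℝ≥0∞, A ≠ ⊤ ∧ ∀ (w : EuclideanSpace ℝ (Fin 3) → ℝ≥0∞), Measurable w →
      ∀ m : ℝ≥0∞, (∀ z, ∫⁻ y in ball z 1, w y ≤ m) →
      ∀ t : ℝ, 0 < t → t ≤ 1 → ∀ x0, ∀ x ∈ ball x0 (3 / 2),
        ∫⁻ y, heatKernelENN t (x - y) * (ball x0 3)ᶜ.indicator w y ≤ A * m := by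
  obtain ⟨A, hAt, hA⟩ := exists_lintegral_gaussian_mul_le
  refine ⟨128 * A, by finiteness, fun w hw m hm t ht ht1 x0 x hx => ?_⟩
  calc ∫⁻ y, heatKernelENN t (x - y) * (ball x0 3)ᶜ.indicator w y
      ≤ ∫⁻ y, 128 * (ENNReal.ofReal (Real.exp (-‖x - y‖ ^ 2 / 8)) * w y) := by
        refine lintegral_mono fun y => ?_
        by_cases hy : y ∈ ball x0 3
        · simp [hy]
        · rw [Set.indicator_of_mem hy, ← mul_assoc]
          gcongr
          have hxy : 1 ≤ ‖x - y‖ := by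
            rw [mem_ball, not_lt] at hy
            rw [mem_ball] at hx
            have := dist_triangle y x x0
            rw [← dist_eq_norm, dist_comm]
            linarith
          calc heatKernelENN t (x - y)
              ≤ ENNReal.ofReal (128 * Real.exp (-‖x - y‖ ^ 2 / 8)) :=
                ENNReal.ofReal_le_ofReal (heatKernel_le_of_one_le_norm ht ht1 hxy)
            _ = _ := by rw [ENNReal.ofReal_mul (by norm_num), ENNReal.ofReal_ofNat]
    _ = 128 * ∫⁻ y, ENNReal.ofReal (Real.exp (-‖x - y‖ ^ 2 / 8)) * w y :=
        lintegral_const_mul _ (by fun_prop)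
    _ ≤ 128 * A * m := by
        rw [mul_assoc]
        gcongr
        exact hA w hw m hm x

lemma lintegral_ball_enorm_le {u : EuclideanSpace ℝ (Fin 3) → ℝ} (hu : AEStronglyMeasurable u)
    {M : ℝ≥0∞} (z : EuclideanSpace ℝ (Fin 3))
    (hM : eLpNorm u 2 (volume.restrict (ball z 1)) ≤ M) :
    ∫⁻ y in ball z 1, ‖u y‖ₑ ≤
      volume (ball (0 : EuclideanSpace ℝ (Fin 3)) 1) ^ (1 / 2 : ℝ) * M := by
  have h := eLpNorm_le_eLpNorm_mul_rpow_measure_univ (p := 1) (q := 2) (by norm_num)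
    (hu.restrict (s := ball z 1))
  rw [eLpNorm_one_eq_lintegral_enorm, Measure.restrict_apply_univ,
    Measure.addHaar_ball_center] at h
  refine h.trans ?_
  rw [mul_comm]
  norm_num
  gcongr

/-- If `u₀ ∈ L²_uloc(ℝ³)` and `u₀ ∈ L³(B(x₀,3))`, then `V = e^{tΔ}u₀` satisfies
`‖V‖_{L⁸(0,T;L⁴(B(x₀,3/2)))} ≤ C(‖u₀‖_{L³(B(x₀,3))} + T^{1/8} ‖u₀‖_{L²_uloc})`
for `0 < T ≤ 1`. -/
theorem heatflow_L8L4_bound :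
    ∃ C : ℝ≥0∞, C ≠ ⊤ ∧
      ∀ (u0 : EuclideanSpace ℝ (Fin 3) → ℝ), LocallyIntegrable u0 volume →
      ∀ M : ℝ≥0∞, (∀ z : EuclideanSpace ℝ (Fin 3),
          eLpNorm u0 2 (volume.restrict (ball z 1)) ≤ M) →
      ∀ x0 : EuclideanSpace ℝ (Fin 3),
        eLpNorm u0 3 (volume.restrict (ball x0 3)) ≠ ⊤ →
      ∀ T : ℝ, 0 < T → T ≤ 1 →
        (∫⁻ t in Set.Ioo (0 : ℝ) T,
            (eLpNorm (fun x => ∫ y, heatKernel t (x - y) * u0 y) 4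
              (volume.restrict (ball x0 (3 / 2)))) ^ (8 : ℝ)) ^ (1 / 8 : ℝ) ≤
          C * (eLpNorm u0 3 (volume.restrict (ball x0 3)) +
            ENNReal.ofReal (T ^ (1 / 8 : ℝ)) * M) := by
  obtain ⟨A, hAt, hA⟩ := exists_far_heat_le
  set β := volume (ball (0 : EuclideanSpace ℝ (Fin 3)) 1)
  have hβt : β ≠ ⊤ := measure_ball_lt_top.ne
  set β' := volume (ball (0 : EuclideanSpace ℝ (Fin 3)) (3 / 2))
  have hβ't : β' ≠ ⊤ := measure_ball_lt_top.ne
  set K := A * β ^ (1 / 2 : ℝ) with hK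
  have hKt : K ≠ ⊤ := ENNReal.mul_ne_top hAt (ENNReal.rpow_ne_top_of_nonneg (by norm_num) hβt)
  set D := 1024 * (4096 + K ^ 8 * β' ^ 2) with hD
  refine ⟨1 + D, by finiteness, fun u0 hu0 M hM x0 hX T hT hT1 => ?_⟩
  have hu : AEMeasurable (fun y => ‖u0 y‖ₑ) volume := hu0.aestronglyMeasurable.enorm
  set w := hu.mk
  have hw : Measurable w := hu.measurable_mk
  have hae : (fun y => ‖u0 y‖ₑ) =ᵐ[volume] w := hu.ae_eq_mk
  set X := eLpNorm u0 3 (volume.restrict (ball x0 3)) with hXdef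
  set h := (ball x0 3).indicator w with hh
  set q := (ball x0 3)ᶜ.indicator w with hq
  have hhm : Measurable h := hw.indicator measurableSet_ball
  have hX3 : ∫⁻ x, h x ^ 3 = X ^ 3 := by
    have h3 := eLpNorm_nnreal_pow_eq_lintegral (f := u0) (p := 3)
      (μ := volume.restrict (ball x0 3)) (by norm_num)
    simp only [ENNReal.coe_ofNat, NNReal.coe_ofNat, ENNReal.rpow_ofNat] at h3
    rw [hXdef, h3, ← lintegral_indicator measurableSet_ball]
    refine lintegral_congr_ae ?_
    filter_upwards [hae] with x hx
    by_cases hxB : x ∈ ball x0 3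
    · rw [hh, Set.indicator_of_mem hxB, Set.indicator_of_mem hxB, ← hx]
    · rw [hh, Set.indicator_of_notMem hxB, Set.indicator_of_notMem hxB, zero_pow three_ne_zero]
  have hloc : ∀ z, ∫⁻ y in ball z 1, w y ≤ β ^ (1 / 2 : ℝ) * M := fun z => by
    rw [← lintegral_congr_ae (ae_restrict_of_ae hae)]
    exact lintegral_ball_enorm_le hu0.aestronglyMeasurable z (hM z)
  have hV : ∀ t : ℝ, 0 < t → ∀ x, ‖∫ y, heatKernel t (x - y) * u0 y‖ₑ ≤
      (∫⁻ y, heatKernelENN t (x - y) * h y) + ∫⁻ y, heatKernelENN t (x - y) * q y := by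
    intro t ht x
    have hk := measurable_heatKernelENN_right t
    refine (enorm_integral_le_lintegral_enorm _).trans (le_of_eq ?_)
    rw [← lintegral_add_left (by fun_prop)]
    refine lintegral_congr_ae ?_
    filter_upwards [hae] with y hy
    rw [enorm_mul, Real.enorm_of_nonneg (heatKernel_nonneg ht.le _), hy, ← mul_add, hh, hq,
      Set.indicator_self_add_compl_apply]
    rfl
  have hspace : ∀ t ∈ Set.Ioo (0 : ℝ) T,
      (eLpNorm (fun x => ∫ y, heatKernel t (x - y) * u0 y) 4
        (volume.restrict (ball x0 (3 / 2)))) ^ (8 : ℝ) ≤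
      1024 * ((∫⁻ x, (∫⁻ y, heatKernelENN t (x - y) * h y) ^ 4) ^ 2 +
        (K * M) ^ 8 * β' ^ 2) := by
    intro t ht
    have h4 := eLpNorm_nnreal_pow_eq_lintegral (p := 4)
      (f := fun x => ∫ y, heatKernel t (x - y) * u0 y)
      (μ := volume.restrict (ball x0 (3 / 2))) (by norm_num)
    simp only [ENNReal.coe_ofNat, NNReal.coe_ofNat, ENNReal.rpow_ofNat] at h4
    have hsplit : ∫⁻ x in ball x0 (3 / 2), ‖∫ y, heatKernel t (x - y) * u0 y‖ₑ ^ 4 ≤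
        2 ^ 4 * ((∫⁻ x, (∫⁻ y, heatKernelENN t (x - y) * h y) ^ 4) + (K * M) ^ 4 * β') := by
      calc _ ≤ ∫⁻ x in ball x0 (3 / 2),
              2 ^ 4 * ((∫⁻ y, heatKernelENN t (x - y) * h y) ^ 4 + (K * M) ^ 4) := by
            refine setLIntegral_mono' measurableSet_ball fun x hx => ?_
            refine le_trans ?_ (ENNReal.add_pow_le_two_pow_mul _ _ 4)
            gcongr
            refine (hV t ht.1 x).trans ?_
            gcongr
            rw [hK, mul_assoc]
            exact hA w hw _ hloc t ht.1 (ht.2.le.trans hT1) x0 x hx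
        _ = 2 ^ 4 * ((∫⁻ x in ball x0 (3 / 2),
              (∫⁻ y, heatKernelENN t (x - y) * h y) ^ 4) + (K * M) ^ 4 * β') := by
            rw [lintegral_const_mul' _ _ (by finiteness), lintegral_add_right _ measurable_const,
              setLIntegral_const, Measure.addHaar_ball_center]
        _ ≤ _ := by
            gcongr
            exact Measure.restrict_le_self
    rw [ENNReal.rpow_ofNat, show (8 : ℕ) = 4 * 2 by norm_num, pow_mul, h4]
    calc _ ≤ (2 ^ 4 * ((∫⁻ x, (∫⁻ y, heatKernelENN t (x - y) * h y) ^ 4) +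
            (K * M) ^ 4 * β')) ^ 2 := by gcongr
      _ = 2 ^ 8 * ((∫⁻ x, (∫⁻ y, heatKernelENN t (x - y) * h y) ^ 4) +
            (K * M) ^ 4 * β') ^ 2 := by ring
      _ ≤ 2 ^ 8 * (2 ^ 2 * ((∫⁻ x, (∫⁻ y, heatKernelENN t (x - y) * h y) ^ 4) ^ 2 +
            ((K * M) ^ 4 * β') ^ 2)) := by
          gcongr; exact ENNReal.add_pow_le_two_pow_mul _ _ _
      _ = _ := by ring
  have hTpow : ENNReal.ofReal (T ^ (1 / 8 : ℝ)) ^ 8 = ENNReal.ofReal T := by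
    rw [← ENNReal.ofReal_pow (by positivity), ← Real.rpow_natCast, ← Real.rpow_mul hT.le]
    norm_num
  set Y := ENNReal.ofReal (T ^ (1 / 8 : ℝ)) * M with hY
  rw [one_div, ENNReal.rpow_inv_le_iff (by norm_num), ENNReal.rpow_ofNat]
  calc _ ≤ ∫⁻ t in Set.Ioo (0 : ℝ) T,
          1024 * ((∫⁻ x, (∫⁻ y, heatKernelENN t (x - y) * h y) ^ 4) ^ 2 +
            (K * M) ^ 8 * β' ^ 2) := setLIntegral_mono' measurableSet_Ioo hspace
    _ = 1024 * ((∫⁻ t in Set.Ioo (0 : ℝ) T,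
          (∫⁻ x, (∫⁻ y, heatKernelENN t (x - y) * h y) ^ 4) ^ 2) +
            (K * M) ^ 8 * β' ^ 2 * ENNReal.ofReal T) := by
        rw [lintegral_const_mul' _ _ (by finiteness), lintegral_add_right _ measurable_const,
          setLIntegral_const, Real.volume_Ioo, sub_zero]
    _ ≤ 1024 * (4096 * X ^ 8 + (K * M) ^ 8 * β' ^ 2 * ENNReal.ofReal T) := by
        gcongr
        exact (lintegral_mono_set Set.Ioo_subset_Ioi_self).trans
          (lintegral_sq_lintegral_heat_pow_four_le hhm hX3 hX)
    _ = 1024 * (4096 * X ^ 8 + K ^ 8 * β' ^ 2 * Y ^ 8) := by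
        rw [hY, mul_pow K, mul_pow _ M, hTpow]; ring
    _ ≤ 1024 * ((4096 + K ^ 8 * β' ^ 2) * X ^ 8 + (4096 + K ^ 8 * β' ^ 2) * Y ^ 8) := by
        gcongr
        · exact le_self_add
        · exact le_add_self
    _ = D * (X ^ 8 + Y ^ 8) := by rw [hD]; ring
    _ ≤ (1 + D) ^ 8 * (X + Y) ^ 8 := by
        gcongr
        · exact le_add_self.trans (le_self_pow le_self_add (by norm_num))
        · exact pow_add_pow_le zero_le zero_le (by norm_num)
    _ = _ := (mul_pow _ _ _).symm
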